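/- Let A and K₀ be linear operators such that ad_A^{N+1}(K₀) = 0. Then for any r ∈ ℕ, ad_A^{2rN}(K₀^{2r}) = ((2rN)! / (N!)^{2r}) · [ad_A^N(K₀)]^{2r}, i.e. the only surviving term in the Leibniz expansion of ad_A^{2rN}(K₀^{2r}) is the one where each factor is ad_A^N(K₀). -/

import Mathlib

/-- The adjoint action `ad_A(B) = A*B - B*A` on linear endomorphisms. -/
def adAction {R : Type*} [CommRing R] {V : Type*} [AddCommGroup V] [Module R V]
    (A : Module.End R V) : Module.End R V → Module.End R V :=
  fun B => A * B - B * A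

lemma adAction_iter_leibniz {V : Type*} [AddCommGroup V] [Module ℂ V]
    (A B C : Module.End ℂ V) (n : ℕ) :
    (adAction A)^[n] (B * C) = ∑ ij ∈ Finset.HasAntidiagonal.antidiagonal n,
      n.choose ij.1 • ((adAction A)^[ij.1] B * (adAction A)^[ij.2] C) := by
  induction n with
  | zero => simp
  | succ n ih =>
    rw [Finset.sum_antidiagonal_choose_succ_nsmul
      (fun i j => (adAction A)^[i] B * (adAction A)^[j] C)]
    rw [Function.iterate_succ_apply', ih, ← Finset.sum_add_distrib]
    conv_lhs => unfold adAction
    rw [Finset.mul_sum, Finset.sum_mul, ← Finset.sum_sub_distrib]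
    refine Finset.sum_congr rfl fun ij hij => ?_
    have hc : n.choose ij.2 = n.choose ij.1 :=
      Nat.choose_symm_of_eq_add (by rw [← Finset.HasAntidiagonal.mem_antidiagonal.1 hij, add_comm])
    change A * (n.choose ij.1 • ((adAction A)^[ij.1] B * (adAction A)^[ij.2] C)) -
      (n.choose ij.1 • ((adAction A)^[ij.1] B * (adAction A)^[ij.2] C)) * A = _
    simp only [Function.iterate_succ_apply', hc]
    generalize (adAction A)^[ij.1] B = X
    generalize (adAction A)^[ij.2] C = Y
    simp only [adAction, mul_smul_comm, smul_mul_assoc, ← smul_sub, ← smul_add]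
    congr 1
    noncomm_ring

lemma adAction_iter_zero_of_le {V : Type*} [AddCommGroup V] [Module ℂ V]
    (A B : Module.End ℂ V) {p n : ℕ} (h : (adAction A)^[p] B = 0) (hn : p ≤ n) :
    (adAction A)^[n] B = 0 := by
  induction n, hn using Nat.le_induction with
  | base => exact h
  | succ n _ ih => rw [Function.iterate_succ_apply', ih]; simp [adAction]

lemma adAction_pow_aux {V : Type*} [AddCommGroup V] [Module ℂ V]
    (A K : Module.End ℂ V) (N : ℕ) (h : (adAction A)^[N + 1] K = 0) (m : ℕ) :
    (adAction A)^[m * N + 1] (K ^ m) = 0 ∧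
    ∃ c : ℕ, c * N.factorial ^ m = (m * N).factorial ∧
      (adAction A)^[m * N] (K ^ m) = c • ((adAction A)^[N] K) ^ m := by
  induction m with
  | zero => exact ⟨by simp [adAction], 1, by simp, by simp⟩
  | succ m ih =>
    obtain ⟨h0, c, hc, hK⟩ := ih
    have e : (m + 1) * N = m * N + N := by ring
    rw [e]
    refine ⟨?_, (m * N + N).choose (m * N) * c, ?_, ?_⟩
    · rw [pow_succ, adAction_iter_leibniz]
      refine Finset.sum_eq_zero fun ij hij => ?_
      have := Finset.HasAntidiagonal.mem_antidiagonal.1 hij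
      by_cases h1 : m * N + 1 ≤ ij.1
      · rw [adAction_iter_zero_of_le A _ h0 h1]; simp
      · rw [adAction_iter_zero_of_le A _ h (show N + 1 ≤ ij.2 by omega)]; simp
    · rw [Nat.choose_symm_add, ← Nat.add_choose_mul_factorial_mul_factorial (m * N) N, ← hc, ← Nat.choose_symm_add]
      ring
    · rw [pow_succ, adAction_iter_leibniz, Finset.sum_eq_single (m * N, N)]
      · simp only [hK, pow_succ, smul_mul_assoc, mul_smul]
      · intro ij hij hne
        have := Finset.HasAntidiagonal.mem_antidiagonal.1 hij
        have hne' : ij.1 ≠ m * N := fun h1 => hne (Prod.ext h1 (by simp only; omega))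
        by_cases h1 : m * N + 1 ≤ ij.1
        · rw [adAction_iter_zero_of_le A _ h0 h1]; simp
        · rw [adAction_iter_zero_of_le A _ h (show N + 1 ≤ ij.2 by omega)]; simp
      · intro hn; exact (hn (by simp)).elim

/-- If `ad_A^{N+1}(K₀) = 0`, then for any `r ∈ ℕ`,
`ad_A^{2rN}(K₀^{2r}) = ((2rN)!/(N!)^{2r}) • (ad_A^N(K₀))^{2r}`:
the only surviving term in the Leibniz expansion is the one where each
factor is `ad_A^N(K₀)`. -/
theorem adAction_top_order {V : Type*} [AddCommGroup V] [Module ℂ V]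
    (A K₀ : Module.End ℂ V) (N : ℕ)
    (h : (adAction A)^[N + 1] K₀ = 0) :
    ∀ r : ℕ,
      (adAction A)^[2 * r * N] (K₀ ^ (2 * r)) =
        (Nat.factorial (2 * r * N) / (Nat.factorial N) ^ (2 * r)) •
          ((adAction A)^[N] K₀) ^ (2 * r) := by
  intro r
  obtain ⟨_, c, hc, hK⟩ := adAction_pow_aux A K₀ N h (2 * r)
  rw [hK, ← hc, Nat.mul_div_cancel _ (by positivity)]
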